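/- Let d, κ, L₁, L₂, β₊, β₋ ∈ (0,∞), c₀ > 1, Γ = (L₁𝕋)×(L₂𝕋), Ω = Γ×(−d,0). Let η̄ : Γ×[−d,0] → ℝ be continuously differentiable, set d̃ = 1+x₃/d, A = ∂₁η̄·d̃, B = ∂₂η̄·d̃, J = 1+η̄/d+∂₃η̄·d̃, K = 1/J, let 𝒜 be the matrix with rows (1,0,−AK), (0,1,−BK), (0,0,K), let η = η̄|_{x₃=0} and 𝒩 = (−∂₁η, −∂₂η, 1), and assume 1/c₀ ≤ J ≤ c₀ on Ω. Then for every continuously differentiable φ : Γ×[−d,0] → ℝ, (min{κπ²/(4d²), β₊β₋/κ}/c₀²) ∫_Ω |φ|² J dx ≤ κ∫_Ω J|∇_𝒜φ|² dx + β₊∫_{Σ₊}|φ|²|𝒩| + β₋∫_{Σ₋}|φ|² K, where (∇_𝒜φ)_i = ∑_k 𝒜_{ik}∂_kφ, Σ₊ = Γ×{0}, Σ₋ = Γ×{−d}. -/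

import Mathlib

open MeasureTheory Real Set

noncomputable section

/-- Partial derivative of `f : ℝ³ → ℝ` in the `i`-th coordinate direction. -/
def pd (i : Fin 3) (f : (Fin 3 → ℝ) → ℝ) (x : Fin 3 → ℝ) : ℝ :=
  fderiv ℝ f x (Pi.single i 1)

/-- Fundamental domain `(0,L₁)×(0,L₂)×(−d,0)` of the periodic slab `Ω = Γ×(−d,0)`. -/
def slab (L₁ L₂ d : ℝ) : Set (Fin 3 → ℝ) :=
  Set.univ.pi ![Ioo 0 L₁, Ioo 0 L₂, Ioo (-d) 0]

/-- Fundamental domain of the horizontal cross-section `Γ = (L₁𝕋)×(L₂𝕋)`. -/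
def rect (L₁ L₂ : ℝ) : Set (ℝ × ℝ) := Ioo 0 L₁ ×ˢ Ioo 0 L₂

lemma continuous_pd (i : Fin 3) {f : (Fin 3 → ℝ) → ℝ} (hf : ContDiff ℝ 1 f) :
    Continuous (pd i f) :=
  (hf.continuous_fderiv one_ne_zero).clm_apply continuous_const

lemma hasDerivAt_vertical {f : (Fin 3 → ℝ) → ℝ} (hf : ContDiff ℝ 1 f) (a b z : ℝ) :
    HasDerivAt (fun t => f ![a, b, t]) (pd 2 f ![a, b, z]) z := by
  have hline : HasDerivAt (fun t : ℝ => (![a, b, t] : Fin 3 → ℝ)) (Pi.single 2 1) z := by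
    rw [hasDerivAt_pi]
    intro i
    fin_cases i
    · simpa using hasDerivAt_const z a
    · simpa using hasDerivAt_const z b
    · exact hasDerivAt_id z
  exact ((hf.differentiable one_ne_zero) ![a, b, z]).hasFDerivAt.comp_hasDerivAt z hline

/-- A Hardy-type lower bound obtained from a subsolution `w` of the Riccati equation
`w' + w² = -ω²`. -/
lemma riccati_lower_bound {a b ω : ℝ} (hab : a ≤ b) {f f' w : ℝ → ℝ}
    (hf : ∀ z, HasDerivAt f (f' z) z) (hf' : Continuous f')
    (hw : ∀ z ∈ Icc a b, HasDerivAt w (-ω ^ 2 - w z ^ 2) z) :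
    ω ^ 2 * (∫ z in a..b, f z ^ 2) + w b * f b ^ 2 - w a * f a ^ 2 ≤
      ∫ z in a..b, f' z ^ 2 := by
  have hfc : Continuous f := continuous_iff_continuousAt.2 fun z => (hf z).continuousAt
  have hderiv : ∀ z ∈ Icc a b, HasDerivAt (fun t => w t * f t ^ 2)
      ((-ω ^ 2 - w z ^ 2) * f z ^ 2 + w z * (2 * f z * f' z)) z := fun z hz => by
    have h := (hw z hz).mul ((hf z).pow 2)
    norm_num at h
    exact h
  have hcont : Continuous fun z => f' z ^ 2 - ω ^ 2 * f z ^ 2 := by fun_prop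
  have key := intervalIntegral.sub_le_integral_of_hasDeriv_right_of_le hab
    (fun z hz => (hderiv z hz).continuousAt.continuousWithinAt)
    (fun z hz => (hderiv z (Ioo_subset_Icc_self hz)).hasDerivWithinAt)
    (hcont.integrableOn_Icc)
    (fun z _ => by nlinarith [sq_nonneg (f' z - w z * f z)])
  rw [intervalIntegral.integral_sub
    ((by fun_prop : Continuous fun z => f' z ^ 2).intervalIntegrable _ _)
    ((by fun_prop : Continuous fun z => ω ^ 2 * f z ^ 2).intervalIntegrable _ _),
    intervalIntegral.integral_const_mul] at key
  linarith

/-- Coercivity of the one-dimensional Robin form on `(-d, 0)`. -/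
lemma robin_interval_coercivity {d κ βp βm : ℝ} (hd : 0 < d) (hκ : 0 < κ)
    (hβp : 0 < βp) (hβm : 0 < βm) {f f' : ℝ → ℝ}
    (hf : ∀ z, HasDerivAt f (f' z) z) (hf' : Continuous f') :
    min (κ * π ^ 2 / (4 * d ^ 2)) (βp * βm / κ) * (∫ z in (-d)..0, f z ^ 2) ≤
      κ * (∫ z in (-d)..0, f' z ^ 2) + βp * f 0 ^ 2 + βm * f (-d) ^ 2 := by
  set m := min (κ * π ^ 2 / (4 * d ^ 2)) (βp * βm / κ)
  have hm0 : 0 < m := lt_min (by positivity) (by positivity)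
  obtain ⟨ω, hω0, hωm⟩ : ∃ ω : ℝ, 0 < ω ∧ κ * ω ^ 2 = m :=
    ⟨√(m / κ), by positivity, by rw [Real.sq_sqrt (by positivity)]; field_simp⟩
  have hωd : ω * d ≤ π / 2 := by
    have h1 : κ * ω ^ 2 ≤ κ * π ^ 2 / (4 * d ^ 2) := hωm ▸ min_le_left _ _
    rw [le_div_iff₀ (by positivity)] at h1
    have h2 : (ω * d) ^ 2 ≤ (π / 2) ^ 2 := by nlinarith
    exact (sq_le_sq₀ (by positivity) (by positivity)).1 h2
  have hωβ : (κ * ω) * (κ * ω) ≤ βp * βm := by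
    have h1 : κ * ω ^ 2 ≤ βp * βm / κ := hωm ▸ min_le_right _ _
    rw [le_div_iff₀ hκ] at h1
    linarith
  set θ := arctan (βp / (κ * ω)) with hθ
  have hθ0 : 0 < θ := Real.arctan_pos.2 (by positivity)
  have hθ1 : θ < π / 2 := Real.arctan_lt_pi_div_two _
  have hsum : ω * d - θ ≤ arctan (βm / (κ * ω)) := by
    have h1 : (βp / (κ * ω))⁻¹ ≤ βm / (κ * ω) := by
      rw [inv_div, div_le_div_iff₀ hβp (by positivity)]
      linarith
    have h2 := Real.arctan_le_arctan_iff.2 h1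
    rw [Real.arctan_inv_of_pos (by positivity)] at h2
    linarith
  have hw : ∀ z ∈ Icc (-d) 0, HasDerivAt (fun t => -ω * tan (ω * t + θ))
      (-ω ^ 2 - (-ω * tan (ω * z + θ)) ^ 2) z := by
    intro z hz
    have hcos : cos (ω * z + θ) ≠ 0 := by
      refine (Real.cos_pos_of_mem_Ioo ⟨?_, ?_⟩).ne'
      · nlinarith [hz.1]
      · nlinarith [hz.2]
    have hlin : HasDerivAt (fun t => ω * t + θ) ω z := by
      simpa using ((hasDerivAt_id z).const_mul ω).add_const θ
    refine (((Real.hasDerivAt_tan hcos).comp z hlin).const_mul (-ω)).congr_deriv ?_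
    rw [Real.tan_eq_sin_div_cos]
    field_simp
    linear_combination Real.sin_sq_add_cos_sq (ω * z + θ)
  have key := riccati_lower_bound (by linarith : -d ≤ 0) hf hf' hw
  have htop : κ * (ω * tan (ω * 0 + θ)) = βp := by
    rw [mul_zero, zero_add, hθ, Real.tan_arctan]
    field_simp
  have hbot : κ * (-ω * tan (ω * (-d) + θ)) ≤ βm := by
    have h1 : tan (ω * d - θ) ≤ βm / (κ * ω) := by
      rw [← Real.tan_arctan (βm / (κ * ω))]
      exact Real.strictMonoOn_tan.monotoneOn ⟨by nlinarith, by linarith⟩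
        ⟨Real.neg_pi_div_two_lt_arctan _, Real.arctan_lt_pi_div_two _⟩ hsum
    rw [le_div_iff₀ (by positivity)] at h1
    rw [show ω * (-d) + θ = -(ω * d - θ) by ring, Real.tan_neg]
    linarith
  have h1 := mul_le_mul_of_nonneg_left key hκ.le
  have h2 := mul_le_mul_of_nonneg_right hbot (sq_nonneg (f (-d)))
  rw [← hωm]
  linear_combination h1 + h2 + f 0 ^ 2 * htop

lemma Continuous.integrableOn_rect {g : ℝ × ℝ → ℝ} (hg : Continuous g) (L₁ L₂ : ℝ) :
    IntegrableOn g (rect L₁ L₂) :=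
  (hg.continuousOn.integrableOn_compact (isCompact_Icc.prod isCompact_Icc)).mono_set
    (Set.prod_mono Ioo_subset_Icc_self Ioo_subset_Icc_self)

lemma Continuous.integrableOn_slab {g : (Fin 3 → ℝ) → ℝ} (hg : Continuous g) (L₁ L₂ d : ℝ) :
    IntegrableOn g (slab L₁ L₂ d) := by
  refine (hg.continuousOn.integrableOn_compact
    (isCompact_Icc (a := ![0, 0, -d]) (b := ![L₁, L₂, 0]))).mono_set ?_
  rw [← Set.pi_univ_Icc]
  refine Set.pi_mono fun i _ => ?_
  fin_cases i <;> exact Ioo_subset_Icc_self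

/-- Fubini's theorem on the slab: integrate along vertical lines first. -/
lemma setIntegral_slab {d : ℝ} (hd : 0 ≤ d) (L₁ L₂ : ℝ) {g : (Fin 3 → ℝ) → ℝ}
    (hg : Continuous g) :
    ∫ x in slab L₁ L₂ d, g x = ∫ p in rect L₁ L₂, ∫ z in (-d)..0, g ![p.1, p.2, z] := by
  let T : (Fin 3 → ℝ) ≃ᵐ ℝ × (ℝ × ℝ) :=
    (MeasurableEquiv.piFinSuccAbove (fun _ => ℝ) 2).trans
      ((MeasurableEquiv.refl ℝ).prodCongr MeasurableEquiv.finTwoArrow)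
  have hT : MeasurePreserving T volume volume :=
    ((MeasurePreserving.id volume).prod (volume_preserving_finTwoArrow ℝ)).comp
      (volume_preserving_piFinSuccAbove (fun _ => ℝ) 2)
  have hTx : ∀ x, T x = (x 2, (x 0, x 1)) := fun x => rfl
  have hpre : T ⁻¹' (Ioo (-d) 0 ×ˢ rect L₁ L₂) = slab L₁ L₂ d := by
    ext x
    simp only [Set.mem_preimage, hTx, rect, slab, Set.mem_prod, Set.mem_univ_pi,
      Fin.forall_fin_succ]
    simp
    tauto
  let G : ℝ × (ℝ × ℝ) → ℝ := fun q => g ![q.2.1, q.2.2, q.1]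
  have hGT : ∀ x, G (T x) = g x := fun x => by
    simp only [G, hTx]
    congr 1
    ext i
    fin_cases i <;> rfl
  have hGc : Continuous G := by fun_prop
  have hGi : IntegrableOn G (Ioo (-d) 0 ×ˢ rect L₁ L₂) (volume.prod volume) :=
    (hGc.continuousOn.integrableOn_compact
      (isCompact_Icc.prod (isCompact_Icc.prod isCompact_Icc))).mono_set
      (Set.prod_mono Ioo_subset_Icc_self
        (Set.prod_mono Ioo_subset_Icc_self Ioo_subset_Icc_self))
  have h1 := hT.setIntegral_preimage_emb T.measurableEmbedding G (Ioo (-d) 0 ×ˢ rect L₁ L₂)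
  rw [hpre] at h1
  simp only [hGT] at h1
  rw [h1, Measure.volume_eq_prod, ← Measure.prod_restrict, integral_prod_symm]
  · refine integral_congr_ae (Filter.Eventually.of_forall fun p => ?_)
    simp only [G]
    rw [intervalIntegral.integral_of_le (by linarith), integral_Ioc_eq_integral_Ioo]
  · rwa [Measure.prod_restrict]

/-- Coercivity of the Robin form on the flat slab. -/
lemma robin_slab_coercivity {d κ βp βm : ℝ} (L₁ L₂ : ℝ) (hd : 0 < d) (hκ : 0 < κ)
    (hβp : 0 < βp) (hβm : 0 < βm) {φ : (Fin 3 → ℝ) → ℝ} (hφ : ContDiff ℝ 1 φ) :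
    min (κ * π ^ 2 / (4 * d ^ 2)) (βp * βm / κ) * (∫ x in slab L₁ L₂ d, φ x ^ 2) ≤
      κ * (∫ x in slab L₁ L₂ d, pd 2 φ x ^ 2)
        + βp * (∫ p in rect L₁ L₂, φ ![p.1, p.2, 0] ^ 2)
        + βm * (∫ p in rect L₁ L₂, φ ![p.1, p.2, -d] ^ 2) := by
  have hc : Continuous φ := hφ.continuous
  have hc' : Continuous (pd 2 φ) := continuous_pd 2 hφ
  have hvert : ∀ g : (Fin 3 → ℝ) → ℝ, Continuous g →
      Continuous fun p : ℝ × ℝ => ∫ z in (-d)..0, g ![p.1, p.2, z] := fun g hg =>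
    intervalIntegral.continuous_parametric_intervalIntegral_of_continuous' (by fun_prop) _ _
  have hsq : Continuous fun x => φ x ^ 2 := hc.pow 2
  have hsq' : Continuous fun x => pd 2 φ x ^ 2 := hc'.pow 2
  have hI0 := ((hvert _ hsq).const_mul
    (min (κ * π ^ 2 / (4 * d ^ 2)) (βp * βm / κ))).integrableOn_rect L₁ L₂
  have hI1 := ((hvert _ hsq').const_mul κ).integrableOn_rect L₁ L₂
  have hI2 := (by fun_prop :
    Continuous fun p : ℝ × ℝ => βp * φ ![p.1, p.2, 0] ^ 2).integrableOn_rect L₁ L₂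
  have hI3 := (by fun_prop :
    Continuous fun p : ℝ × ℝ => βm * φ ![p.1, p.2, -d] ^ 2).integrableOn_rect L₁ L₂
  rw [setIntegral_slab hd.le L₁ L₂ hsq, setIntegral_slab hd.le L₁ L₂ hsq']
  simp only [← integral_const_mul]
  have hI12 : IntegrableOn (fun p : ℝ × ℝ => κ * (∫ z in (-d)..0, pd 2 φ ![p.1, p.2, z] ^ 2) +
    βp * φ ![p.1, p.2, 0] ^ 2) (rect L₁ L₂) := hI1.add hI2
  rw [← integral_add hI1 hI2, ← integral_add hI12 hI3]
  refine setIntegral_mono hI0 (hI12.add hI3) fun p => ?_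
  exact robin_interval_coercivity hd hκ hβp hβm
    (fun z => hasDerivAt_vertical hφ p.1 p.2 z) (by fun_prop)

/-- **Coercivity of the moving-boundary dissipation functional on a periodic slab,
Robin case.**  With `J = det ∇Φ` of the flattening map satisfying `1/c₀ ≤ J ≤ c₀`,
`𝒜 = (∇Φ⁻¹)ᵀ`, and `𝒩` the non-unit upward normal, for every `C¹` horizontally
periodic `φ`,
`(min{κπ²/(4d²), β₊β₋/κ}/c₀²) ∫_Ω |φ|² J ≤ κ∫_Ω J|∇_𝒜φ|² + β₊∫_{Σ₊}|φ|²|𝒩| +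
β₋∫_{Σ₋}|φ|² K`. -/
theorem moving_coercivity_robin
    (d κ L₁ L₂ βp βm c₀ : ℝ)
    (hd : 0 < d) (hκ : 0 < κ) (hL₁ : 0 < L₁) (hL₂ : 0 < L₂)
    (hβp : 0 < βp) (hβm : 0 < βm) (hc₀ : 1 < c₀)
    (ηb : (Fin 3 → ℝ) → ℝ) (hηb : ContDiff ℝ 1 ηb)
    (hη_per1 : ∀ x, ηb (x + Pi.single 0 L₁) = ηb x)
    (hη_per2 : ∀ x, ηb (x + Pi.single 1 L₂) = ηb x)
    (A B J K : (Fin 3 → ℝ) → ℝ) (𝒜 : (Fin 3 → ℝ) → Matrix (Fin 3) (Fin 3) ℝ)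
    (hA : ∀ x, A x = pd 0 ηb x * (1 + x 2 / d))
    (hB : ∀ x, B x = pd 1 ηb x * (1 + x 2 / d))
    (hJ : ∀ x, J x = 1 + ηb x / d + pd 2 ηb x * (1 + x 2 / d))
    (hK : ∀ x, K x = (J x)⁻¹)
    (h𝒜 : ∀ x, 𝒜 x =
      !![1, 0, -(A x * K x); 0, 1, -(B x * K x); 0, 0, K x])
    (hJbd : ∀ x, 1 / c₀ ≤ J x ∧ J x ≤ c₀)
    (φ : (Fin 3 → ℝ) → ℝ) (hφ : ContDiff ℝ 1 φ)
    (hφ_per1 : ∀ x, φ (x + Pi.single 0 L₁) = φ x)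
    (hφ_per2 : ∀ x, φ (x + Pi.single 1 L₂) = φ x) :
    min (κ * π ^ 2 / (4 * d ^ 2)) (βp * βm / κ) / c₀ ^ 2 *
        (∫ x in slab L₁ L₂ d, (φ x) ^ 2 * J x) ≤
      κ * (∫ x in slab L₁ L₂ d, J x * ∑ i, (∑ k, 𝒜 x i k * pd k φ x) ^ 2)
        + βp * (∫ p in rect L₁ L₂, (φ ![p.1, p.2, 0]) ^ 2 *
            Real.sqrt (1 + (pd 0 ηb ![p.1, p.2, 0]) ^ 2 + (pd 1 ηb ![p.1, p.2, 0]) ^ 2))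
        + βm * (∫ p in rect L₁ L₂, (φ ![p.1, p.2, -d]) ^ 2 * K ![p.1, p.2, -d]) := by
  have hc₀0 : 0 < c₀ := by linarith
  have hJ0 : ∀ x, 0 < J x := fun x => lt_of_lt_of_le (by positivity) (hJbd x).1
  have hKlb : ∀ x, 1 / c₀ ≤ K x := fun x => by
    rw [hK, ← one_div]
    exact one_div_le_one_div_of_le (hJ0 x) (hJbd x).2
  have hφc : Continuous φ := hφ.continuous
  have hηc : Continuous ηb := hηb.continuous
  have hpdφ : ∀ i, Continuous (pd i φ) := fun i => continuous_pd i hφ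
  have hpdη : ∀ i, Continuous (pd i ηb) := fun i => continuous_pd i hηb
  have hη0 := hpdη 0
  have hη1 := hpdη 1
  have hη2 := hpdη 2
  have hφ0 := hpdφ 0
  have hφ1 := hpdφ 1
  have hφ2 := hpdφ 2
  have hAc : Continuous A := by rw [funext hA]; fun_prop
  have hBc : Continuous B := by rw [funext hB]; fun_prop
  have hJc : Continuous J := by rw [funext hJ]; fun_prop
  have hKc : Continuous K := by rw [funext hK]; exact hJc.inv₀ fun x => (hJ0 x).ne'
  have hgrad : ∀ x, J x * ∑ i, (∑ k, 𝒜 x i k * pd k φ x) ^ 2 =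
      J x * ((pd 0 φ x - A x * K x * pd 2 φ x) ^ 2 + (pd 1 φ x - B x * K x * pd 2 φ x) ^ 2
        + (K x * pd 2 φ x) ^ 2) := fun x => by
    rw [h𝒜]
    congr 1
    simp [Fin.sum_univ_three]
    ring
  simp only [hgrad]
  set m := min (κ * π ^ 2 / (4 * d ^ 2)) (βp * βm / κ)
  have hm0 : 0 < m := lt_min (by positivity) (by positivity)
  have hflat : m * (∫ x in slab L₁ L₂ d, φ x ^ 2) ≤ _ :=
    robin_slab_coercivity L₁ L₂ hd hκ hβp hβm hφ
  have hmass : (∫ x in slab L₁ L₂ d, φ x ^ 2 * J x) ≤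
      c₀ * ∫ x in slab L₁ L₂ d, φ x ^ 2 := by
    rw [← integral_const_mul]
    refine setIntegral_mono ((by fun_prop : Continuous _).integrableOn_slab _ _ _)
      ((by fun_prop : Continuous _).integrableOn_slab _ _ _) fun x => ?_
    simp only
    nlinarith [sq_nonneg (φ x), (hJbd x).2]
  have hdiss : 1 / c₀ * (∫ x in slab L₁ L₂ d, pd 2 φ x ^ 2) ≤
      ∫ x in slab L₁ L₂ d, J x * ((pd 0 φ x - A x * K x * pd 2 φ x) ^ 2
        + (pd 1 φ x - B x * K x * pd 2 φ x) ^ 2 + (K x * pd 2 φ x) ^ 2) := by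
    rw [← integral_const_mul]
    refine setIntegral_mono ((by fun_prop : Continuous _).integrableOn_slab _ _ _)
      ((by fun_prop : Continuous _).integrableOn_slab _ _ _) fun x => ?_
    calc 1 / c₀ * pd 2 φ x ^ 2 ≤ K x * pd 2 φ x ^ 2 :=
          mul_le_mul_of_nonneg_right (hKlb x) (sq_nonneg _)
      _ = J x * (K x * pd 2 φ x) ^ 2 := by
          have := (hJ0 x).ne'
          rw [hK]
          field_simp
      _ ≤ _ := mul_le_mul_of_nonneg_left (by
          linarith [sq_nonneg (pd 0 φ x - A x * K x * pd 2 φ x),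
            sq_nonneg (pd 1 φ x - B x * K x * pd 2 φ x)]) (hJ0 x).le
  have htop : 1 / c₀ * (∫ p in rect L₁ L₂, φ ![p.1, p.2, 0] ^ 2) ≤
      ∫ p in rect L₁ L₂, (φ ![p.1, p.2, 0]) ^ 2 *
        Real.sqrt (1 + (pd 0 ηb ![p.1, p.2, 0]) ^ 2 + (pd 1 ηb ![p.1, p.2, 0]) ^ 2) := by
    rw [← integral_const_mul]
    refine setIntegral_mono ((by fun_prop : Continuous _).integrableOn_rect _ _)
      ((by fun_prop : Continuous _).integrableOn_rect _ _) fun p => ?_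
    have hc : 1 / c₀ ≤ 1 := by rw [div_le_one hc₀0]; exact hc₀.le
    have hN : 1 ≤ Real.sqrt (1 + (pd 0 ηb ![p.1, p.2, 0]) ^ 2
        + (pd 1 ηb ![p.1, p.2, 0]) ^ 2) := by
      rw [Real.one_le_sqrt]
      nlinarith [sq_nonneg (pd 0 ηb ![p.1, p.2, 0]), sq_nonneg (pd 1 ηb ![p.1, p.2, 0])]
    simp only
    rw [mul_comm]
    exact mul_le_mul_of_nonneg_left (hc.trans hN) (sq_nonneg _)
  have hbot : 1 / c₀ * (∫ p in rect L₁ L₂, φ ![p.1, p.2, -d] ^ 2) ≤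
      ∫ p in rect L₁ L₂, (φ ![p.1, p.2, -d]) ^ 2 * K ![p.1, p.2, -d] := by
    rw [← integral_const_mul]
    refine setIntegral_mono ((by fun_prop : Continuous _).integrableOn_rect _ _)
      ((by fun_prop : Continuous _).integrableOn_rect _ _) fun p => ?_
    simp only
    rw [mul_comm]
    exact mul_le_mul_of_nonneg_left (hKlb _) (sq_nonneg _)
  have hcalc : m / c₀ ^ 2 * (∫ x in slab L₁ L₂ d, φ x ^ 2 * J x) ≤
      1 / c₀ * (m * ∫ x in slab L₁ L₂ d, φ x ^ 2) := by
    refine (mul_le_mul_of_nonneg_left hmass (by positivity)).trans_eq ?_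
    field_simp
  have hscaled := mul_le_mul_of_nonneg_left hflat (by positivity : 0 ≤ 1 / c₀)
  have h1 := mul_le_mul_of_nonneg_left hdiss hκ.le
  have h2 := mul_le_mul_of_nonneg_left htop hβp.le
  have h3 := mul_le_mul_of_nonneg_left hbot hβm.le
  linarith
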